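/- Let t, z be real numbers with t·z ≠ 0 and t·z ≠ −1, and let M be the 4×4 real matrix with rows (1+4zt, 0, 0, 2z), (0, −1, 0, 0), (0, 0, −1, 0), (2t, 0, 0, 1). Then the minimal polynomial of M over ℝ equals (X + 1)·(X² − (2 + 4tz)·X + 1). -/

import Mathlib

open Matrix Polynomial

/-- For `tz ≠ 0` and `tz ≠ −1`, the minimal polynomial of the matrix `M` of the scaled
Clifford antipode `μS` is `(X + 1)(X² − (2 + 4tz)X + 1)`. -/
theorem minpoly_mu_antipode (t z : ℝ) (h0 : t * z ≠ 0) (h1 : t * z ≠ -1) :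
    minpoly ℝ (!![1 + 4 * z * t, 0, 0, 2 * z;
                  0, -1, 0, 0;
                  0, 0, -1, 0;
                  2 * t, 0, 0, 1] : Matrix (Fin 4) (Fin 4) ℝ) =
      (X + 1) * (X ^ 2 - C (2 + 4 * t * z) * X + 1) := by
  have hp : ((X + 1) * (X ^ 2 - C (2 + 4 * t * z) * X + 1) : ℝ[X]) =
      X ^ 3 + C (-(1 + 4 * t * z)) * X ^ 2 + C (-(1 + 4 * t * z)) * X + C 1 := by
    simp only [map_add, map_mul, map_neg, map_one]
    have h2 : (C (2 : ℝ) : ℝ[X]) = 2 := rfl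
    rw [h2]
    ring
  have hdeg : ((X + 1) * (X ^ 2 - C (2 + 4 * t * z) * X + 1) : ℝ[X]).degree = 3 := by
    rw [hp]; compute_degree!
  symm
  apply minpoly.unique'
  · rw [hp]; monicity!
  · rw [hp]
    ext i j
    fin_cases i <;> fin_cases j <;>
      simp [pow_succ, Matrix.mul_apply, Fin.sum_univ_four, Algebra.algebraMap_eq_smul_one,
        Matrix.one_apply] <;> ring
  · intro q hq
    rw [hdeg] at hq
    by_cases hq0 : q = 0
    · exact Or.inl hq0
    right
    intro hM
    have hn : q.natDegree < 3 := (natDegree_lt_iff_degree_lt hq0).2 hq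
    apply hq0
    have hs := q.as_sum_range_C_mul_X_pow' hn
    simp only [Finset.sum_range_succ, Finset.sum_range_zero] at hs
    generalize q.coeff 0 = c at hs
    generalize q.coeff 1 = b at hs
    generalize q.coeff 2 = a at hs
    rw [hs] at hM
    have e1 := congrFun (congrFun hM 3) 0
    have e2 := congrFun (congrFun hM 1) 1
    have e3 := congrFun (congrFun hM 3) 3
    simp [pow_succ, Matrix.mul_apply, Fin.sum_univ_four, Algebra.algebraMap_eq_smul_one,
      Matrix.one_apply] at e1 e2 e3
    have ht : t ≠ 0 := left_ne_zero_of_mul h0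
    have hb : b = -a * (2 + 4 * t * z) := by
      apply mul_left_cancel₀ (mul_ne_zero two_ne_zero ht)
      linear_combination e1
    have hc : c = a := by
      subst hb
      linear_combination e3
    have ha : a = 0 := by
      have h3 : t * z + 1 ≠ 0 := fun h => h1 (by linarith)
      apply (mul_eq_zero.1 (_ : a * (t * z + 1) = 0)).resolve_right h3
      subst hb
      subst hc
      linear_combination e2 / 4
    subst ha
    rw [hs, hc, hb]
    simp
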